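/- All directed Huffman trees generated by a tuple ⟨μ,d⟩ with degree-monotone weights share the same vector of subordinate groups' weights: if T, H ∈ ℛℋ(μ,d), then f(T) = f(H). -/

import Mathlib

open scoped Classical
noncomputable section

/-- A directed tree on a finite vertex set `V`: each vertex has an outbound arc to its
`parent`, the `root` is a fixed point of `parent` (i.e. has no genuine outbound arc), and
every vertex reaches the root by iterating `parent`. -/
structure DirTree (V : Type) [Fintype V] [DecidableEq V] where
  root : V
  parent : V → V
  parent_root : parent root = root
  reaches : ∀ v, ∃ n, parent^[n] v = root

variable {V : Type} [Fintype V] [DecidableEq V]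

namespace DirTree

/-- `u` belongs to the subordinate group of `v`: there is a directed path from `u` to `v`. -/
def Desc (T : DirTree V) (u v : V) : Prop := ∃ n, T.parent^[n] u = v

/-- The set of vertices with an arc to `v`. -/
def children (T : DirTree V) (v : V) : Finset V :=
  Finset.univ.filter fun u => T.parent u = v ∧ u ≠ v

/-- Weight `f_T(v)` of the subordinate group of `v`. -/
def f (T : DirTree V) (μ : V → ℝ) (v : V) : ℝ :=
  ∑ u ∈ Finset.univ.filter (fun u => T.Desc u v), μ u

/-- Degree of `v` in the underlying undirected tree. -/
def deg (T : DirTree V) (v : V) : ℕ :=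
  (T.children v).card + (if v = T.root then 0 else 1)

/-- The underlying undirected tree. -/
def toGraph (T : DirTree V) : SimpleGraph V :=
  SimpleGraph.fromRel fun u v => T.parent u = v ∧ u ≠ v

/-- The vector (as a multiset, i.e. up to ascending rearrangement) of subordinate
groups' weights of internal non-root vertices. -/
def fvec (T : DirTree V) (μ : V → ℝ) : Multiset ℝ :=
  (Finset.univ.filter fun m => 1 < T.deg m ∧ m ≠ T.root).val.map (T.f μ)

end DirTree

/-- Degree of a vertex in a simple graph. -/
def gdeg (G : SimpleGraph V) (v : V) : ℕ :=
  (Finset.univ.filter fun u => G.Adj v u).card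

/-- `⟨μ, d⟩` is a generating tuple: nonnegative weights, degrees at least 1 summing to
`2(|V|-1)`, at least two pendent and at least one internal vertex. -/
structure IsGenTuple (μ : V → ℝ) (d : V → ℕ) : Prop where
  nonneg : ∀ v, 0 ≤ μ v
  deg_pos : ∀ v, 1 ≤ d v
  sum_deg : ∑ v, d v = 2 * (Fintype.card V - 1)
  two_le_pendent : 2 ≤ (Finset.univ.filter fun v => d v = 1).card
  one_le_internal : 1 ≤ (Finset.univ.filter fun v => 1 < d v).card

/-- Weights are degree-monotone in `⟨μ, d⟩`. -/
def DegMonotone (μ : V → ℝ) (d : V → ℕ) : Prop :=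
  (∀ m m', 1 < d m → 1 < d m' → d m < d m' → μ m ≤ μ m') ∧
  ∀ v, d v = 1 → 0 < μ v

/-- `T ∈ ℛ(μ,d)`: directed tree with internal root whose (undirected) degrees match `d`. -/
def memR (T : DirTree V) (d : V → ℕ) : Prop :=
  1 < d T.root ∧ ∀ v, T.deg v = d v

/-- `G ∈ 𝒯(μ,d)`: `G` is a tree whose degrees match `d`. -/
def memT (G : SimpleGraph V) (d : V → ℕ) : Prop :=
  G.IsTree ∧ ∀ v, gdeg G v = d v

/-- Vertex-weighted Wiener index. -/
def VWWI (μ : V → ℝ) (G : SimpleGraph V) : ℝ :=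
  (1 / 2) * ∑ u, ∑ v, μ u * μ v * (G.dist u v : ℝ)

/-- `S = (m, L)` is a minimal star for the state `(U, μ, d)`: the center `m` is an
internal vertex of `U` of least degree among internal vertices of least weight, and the
`d m - 1` leaves `L` are pendent vertices of `U` of least weights. -/
def IsMinimalStar (U : Finset V) (μ : V → ℝ) (d : V → ℕ) (m : V) (L : Finset V) : Prop :=
  m ∈ U ∧ 1 < d m ∧ L ⊆ U ∧ m ∉ L ∧ L.card = d m - 1 ∧
  (∀ v ∈ L, d v = 1) ∧
  (∀ m' ∈ U, 1 < d m' → μ m ≤ μ m') ∧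
  (∀ m' ∈ U, 1 < d m' → μ m' = μ m → d m ≤ d m') ∧
  ∀ u ∈ L, ∀ w ∈ U, d w = 1 → w ∉ L → μ u ≤ μ w

/-- Centers used before step `i` (0-indexed). -/
def usedCenters {q : ℕ} (c : Fin q → V) (i : ℕ) : Finset V :=
  (Finset.univ.filter fun j : Fin q => (j : ℕ) < i).image c

/-- Vertex set `V_{i+1}` of the state of the Huffman algorithm before (0-indexed) step `i`,
for the candidate Huffman tree `T` with star centers `c`. -/
def stateV (T : DirTree V) {q : ℕ} (c : Fin q → V) (i : ℕ) : Finset V :=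
  Finset.univ \ (Finset.univ.filter fun j : Fin q => (j : ℕ) < i).biUnion fun j => T.children (c j)

/-- Weight function `μ^{i+1}` of the state before (0-indexed) step `i`. -/
def stateMu (T : DirTree V) (μ : V → ℝ) {q : ℕ} (c : Fin q → V) (i : ℕ) : V → ℝ :=
  fun v => if v ∈ usedCenters c i then T.f μ v else μ v

/-- Degree function `d^{i+1}` of the state before (0-indexed) step `i`. -/
def stateD (d : V → ℕ) {q : ℕ} (c : Fin q → V) (i : ℕ) : V → ℕ :=
  fun v => if v ∈ usedCenters c i then 1 else d v

/-- `T` is a directed Huffman tree for `⟨μ, d⟩` whose star sequence has centers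
`c 0, …, c (q-1)` (so `S_i` has leaf set `children (c i)`): the centers enumerate the
internal vertices, the root is the last center, and at each of the first `q - 1` steps
the corresponding star is a minimal star of the current state. -/
def IsHuffmanSeq (μ : V → ℝ) (d : V → ℕ) (T : DirTree V) {q : ℕ} (c : Fin q → V) : Prop :=
  (∀ v, T.deg v = d v) ∧
  Function.Injective c ∧
  (∀ v, 1 < d v ↔ ∃ j, c j = v) ∧
  (∀ hq : 0 < q, T.root = c ⟨q - 1, Nat.sub_lt hq Nat.one_pos⟩) ∧
  ∀ i : Fin q, (i : ℕ) < q - 1 →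
    IsMinimalStar (stateV T c (i : ℕ)) (stateMu T μ c (i : ℕ)) (stateD d c (i : ℕ))
      (c i) (T.children (c i))

/-- `T ∈ ℛℋ(μ,d)`: `T` is a directed Huffman tree for `⟨μ, d⟩`. -/
def IsHuffmanDir (μ : V → ℝ) (d : V → ℕ) (T : DirTree V) : Prop :=
  ∃ (q : ℕ) (c : Fin q → V), IsHuffmanSeq μ d T c

/-- Sum of the `k` smallest components of a multiset of reals. -/
def ascSum (s : Multiset ℝ) (k : ℕ) : ℝ := ((s.sort (· ≤ ·)).take k).sum

/-- `x` weakly majorizes `y` (`y ⪯^w x`). -/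
def WMaj (x y : Multiset ℝ) : Prop :=
  Multiset.card x = Multiset.card y ∧ ∀ k, ascSum x k ≤ ascSum y k

/-- `x` strictly weakly majorizes `y` (`y ≺^w x`). -/
def SWMaj (x y : Multiset ℝ) : Prop := WMaj x y ∧ x ≠ y

namespace DirTree

theorem iterate_parent_root (T : DirTree V) (n : ℕ) : T.parent^[n] T.root = T.root :=
  Function.iterate_fixed T.parent_root n

theorem eq_root_of_iterate_eq_self (T : DirTree V) {v : V} {n : ℕ} (hn : 0 < n)
    (h : T.parent^[n] v = v) : v = T.root := by
  obtain ⟨m, hm⟩ := T.reaches v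
  have h1 : T.parent^[n * m] v = v := by
    rw [Function.iterate_mul]
    exact Function.iterate_fixed h m
  have h2 : n * m = (n * m - m) + m := by
    have := Nat.le_mul_of_pos_left m hn
    omega
  rw [h2, Function.iterate_add_apply, hm, iterate_parent_root] at h1
  exact h1.symm

theorem mem_children {T : DirTree V} {u v : V} :
    u ∈ T.children v ↔ T.parent u = v ∧ u ≠ v := by
  simp [children]

theorem not_desc_of_mem_children (T : DirTree V) {u v : V} (hu : u ∈ T.children v) :
    ¬ T.Desc v u := by
  rintro ⟨n, hn⟩
  obtain ⟨hp, hne⟩ := mem_children.1 hu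
  have hv : v = T.root := by
    refine T.eq_root_of_iterate_eq_self (Nat.succ_pos n) ?_
    rw [Function.iterate_succ_apply', hn, hp]
  rw [hv, iterate_parent_root] at hn
  exact hne (hn.symm.trans hv.symm)

theorem desc_iff (T : DirTree V) (w v : V) :
    T.Desc w v ↔ w = v ∨ ∃ u ∈ T.children v, T.Desc w u := by
  constructor
  · rintro ⟨n, hn⟩
    induction n with
    | zero => exact Or.inl hn
    | succ n ih =>
      rw [Function.iterate_succ_apply'] at hn
      by_cases h : T.parent^[n] w = v
      · exact ih h
      · exact Or.inr ⟨_, mem_children.2 ⟨hn, h⟩, n, rfl⟩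
  · rintro (rfl | ⟨u, hu, n, hn⟩)
    · exact ⟨0, rfl⟩
    · exact ⟨n + 1, by rw [Function.iterate_succ_apply', hn, (mem_children.1 hu).1]⟩

theorem eq_of_iterate_mem_children (T : DirTree V) {u u' v w : V} (hu : u ∈ T.children v)
    (hu' : u' ∈ T.children v) {a b : ℕ} (hab : a ≤ b) (ha : T.parent^[a] w = u)
    (hb : T.parent^[b] w = u') : u = u' := by
  obtain ⟨k, rfl⟩ := Nat.exists_eq_add_of_le' hab
  rw [Function.iterate_add_apply, ha] at hb
  cases k with
  | zero => exact hb
  | succ k =>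
    rw [Function.iterate_succ_apply, (mem_children.1 hu).1] at hb
    exact absurd ⟨k, hb⟩ (T.not_desc_of_mem_children hu')

theorem f_eq_add_sum_children (T : DirTree V) (μ : V → ℝ) (v : V) :
    T.f μ v = μ v + ∑ u ∈ T.children v, T.f μ u := by
  have hset : (Finset.univ.filter fun w => T.Desc w v) =
      insert v ((T.children v).biUnion fun u => Finset.univ.filter fun w => T.Desc w u) := by
    ext w
    simp [T.desc_iff w v]
  rw [f, hset, Finset.sum_insert, Finset.sum_biUnion]
  · rfl
  · intro u hu u' hu' hne
    refine Finset.disjoint_left.2 fun w hw hw' => hne ?_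
    obtain ⟨a, ha⟩ := (Finset.mem_filter.1 hw).2
    obtain ⟨b, hb⟩ := (Finset.mem_filter.1 hw').2
    rcases le_total a b with hab | hab
    · exact T.eq_of_iterate_mem_children hu hu' hab ha hb
    · exact (T.eq_of_iterate_mem_children hu' hu hab hb ha).symm
  · simp only [Finset.mem_biUnion, Finset.mem_filter, Finset.mem_univ, true_and, not_exists,
      not_and]
    exact fun u hu => T.not_desc_of_mem_children hu

end DirTree

theorem Multiset.eq_of_add_eq_add_of_le {α : Type*} [LinearOrder α] {A B A' B' : Multiset α}
    (h : A + B = A' + B') (hcard : A.card = A'.card) (hAB : ∀ a ∈ A, ∀ b ∈ B, a ≤ b)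
    (hAB' : ∀ a ∈ A', ∀ b ∈ B', a ≤ b) : A = A' ∧ B = B' := by
  have key : ∀ C D : Multiset α, (∀ a ∈ C, ∀ b ∈ D, a ≤ b) →
      (C + D).sort (· ≤ ·) = C.sort (· ≤ ·) ++ D.sort (· ≤ ·) := by
    intro C D hCD
    refine List.Perm.eq_of_pairwise' (r := (· ≤ ·)) (Multiset.pairwise_sort _ _) ?_ ?_
    · refine List.pairwise_append.2
        ⟨Multiset.pairwise_sort _ _, Multiset.pairwise_sort _ _, fun a ha b hb => ?_⟩
      exact hCD a ((Multiset.mem_sort _).1 ha) b ((Multiset.mem_sort _).1 hb)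
    · rw [← Multiset.coe_eq_coe, ← Multiset.coe_add]
      simp only [Multiset.sort_eq]
  have hs := key A B hAB
  rw [h, key A' B' hAB'] at hs
  have hA := (List.append_inj hs (by simp [hcard])).1
  have hAA : A = A' := by
    rw [← Multiset.sort_eq A (· ≤ ·), ← hA, Multiset.sort_eq]
  subst hAA
  exact ⟨rfl, add_left_cancel h⟩

/-- One step of the Huffman algorithm on the level of weights: `A` and `A'` are the multisets of
(weight, degree) pairs of the internal vertices before and after the step, `B` and `B'` the
multisets of weights of the pendent vertices, and `x` is the weight of the minimal star. -/
def WeightStep (A : Multiset (ℝ × ℕ)) (B : Multiset ℝ) (A' : Multiset (ℝ × ℕ))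
    (B' : Multiset ℝ) (x : ℝ) : Prop :=
  ∃ (p : ℝ × ℕ) (L R : Multiset ℝ), A = p ::ₘ A' ∧
    (∀ r ∈ A, p.1 ≤ r.1 ∧ (r.1 = p.1 → p.2 ≤ r.2)) ∧
    L.card = p.2 - 1 ∧ B = L + R ∧ (∀ a ∈ L, ∀ b ∈ R, a ≤ b) ∧
    x = p.1 + L.sum ∧ B' = x ::ₘ R

theorem WeightStep.unique {A A₁ A₂ : Multiset (ℝ × ℕ)} {B B₁ B₂ : Multiset ℝ} {x₁ x₂ : ℝ}
    (h₁ : WeightStep A B A₁ B₁ x₁) (h₂ : WeightStep A B A₂ B₂ x₂) :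
    A₁ = A₂ ∧ B₁ = B₂ ∧ x₁ = x₂ := by
  obtain ⟨p, L, R, hA, hmin, hL, hB, hle, rfl, rfl⟩ := h₁
  obtain ⟨p', L', R', hA', hmin', hL', hB', hle', rfl, rfl⟩ := h₂
  obtain ⟨h1, h2⟩ := hmin p' (by simp [hA'])
  obtain ⟨h1', h2'⟩ := hmin' p (by simp [hA])
  have e1 : p.1 = p'.1 := le_antisymm h1 h1'
  have e2 : p.2 = p'.2 := le_antisymm (h2 e1.symm) (h2' e1)
  obtain rfl : p = p' := Prod.ext e1 e2
  obtain ⟨rfl, rfl⟩ := Multiset.eq_of_add_eq_add_of_le (hB.symm.trans hB')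
    (hL.trans hL'.symm) hle hle'
  exact ⟨(Multiset.cons_inj_right p).1 (hA.symm.trans hA'), rfl, rfl⟩

/-- Internal vertices of the state before step `i`. -/
def stateInternal (T : DirTree V) (d : V → ℕ) {q : ℕ} (c : Fin q → V) (i : ℕ) : Finset V :=
  (stateV T c i).filter fun v => 1 < stateD d c i v

/-- Pendent vertices of the state before step `i`. -/
def statePendent (T : DirTree V) (d : V → ℕ) {q : ℕ} (c : Fin q → V) (i : ℕ) : Finset V :=
  (stateV T c i).filter fun v => stateD d c i v = 1

theorem mem_usedCenters {q : ℕ} {c : Fin q → V} {i : ℕ} {v : V} :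
    v ∈ usedCenters c i ↔ ∃ j : Fin q, (j : ℕ) < i ∧ c j = v := by
  simp [usedCenters]

theorem mem_stateV {T : DirTree V} {q : ℕ} {c : Fin q → V} {i : ℕ} {v : V} :
    v ∈ stateV T c i ↔ ∀ j : Fin q, (j : ℕ) < i → v ∉ T.children (c j) := by
  simp [stateV]

theorem usedCenters_succ {q : ℕ} (c : Fin q → V) (i : Fin q) :
    usedCenters c (i + 1) = insert (c i) (usedCenters c i) := by
  ext v
  simp only [mem_usedCenters, Finset.mem_insert]
  constructor
  · rintro ⟨j, hj, rfl⟩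
    rcases Nat.lt_succ_iff_lt_or_eq.1 hj with h | h
    · exact Or.inr ⟨j, h, rfl⟩
    · exact Or.inl (congrArg c (Fin.ext h))
  · rintro (rfl | ⟨j, hj, rfl⟩)
    · exact ⟨i, Nat.lt_succ_self _, rfl⟩
    · exact ⟨j, Nat.lt_succ_of_lt hj, rfl⟩

theorem stateV_succ (T : DirTree V) {q : ℕ} (c : Fin q → V) (i : Fin q) :
    stateV T c (i + 1) = stateV T c i \ T.children (c i) := by
  ext v
  simp only [mem_stateV, Finset.mem_sdiff]
  constructor
  · exact fun h => ⟨fun j hj => h j (Nat.lt_succ_of_lt hj), h i (Nat.lt_succ_self _)⟩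
  · rintro ⟨h, hi⟩ j hj
    rcases Nat.lt_succ_iff_lt_or_eq.1 hj with h' | h'
    · exact h j h'
    · rwa [Fin.ext h']

theorem stateD_succ (d : V → ℕ) {q : ℕ} (c : Fin q → V) (i : Fin q) (v : V) :
    stateD d c (i + 1) v = if v = c i then 1 else stateD d c i v := by
  simp only [stateD, usedCenters_succ, Finset.mem_insert]
  split_ifs <;> simp_all

theorem notMem_usedCenters_of_one_lt_stateD {d : V → ℕ} {q : ℕ} {c : Fin q → V} {i : ℕ} {v : V}
    (h : 1 < stateD d c i v) : v ∉ usedCenters c i := by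
  intro hv
  simp [stateD, hv] at h

namespace IsHuffmanSeq

variable {μ : V → ℝ} {d : V → ℕ} {T : DirTree V} {q : ℕ} {c : Fin q → V}

theorem card_eq (h : IsHuffmanSeq μ d T c) :
    q = (Finset.univ.filter fun v => 1 < d v).card := by
  obtain ⟨-, hinj, hc, -, -⟩ := h
  have : (Finset.univ.filter fun v => 1 < d v) = Finset.univ.image c := by
    ext v
    simp [hc v]
  rw [this, Finset.card_image_of_injective _ hinj, Finset.card_univ, Fintype.card_fin]

theorem f_eq_of_pendent (h : IsHuffmanSeq μ d T c) (hq : 0 < q) {v : V} (hv : d v = 1) :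
    T.f μ v = μ v := by
  obtain ⟨hdeg, -, hc, hroot, -⟩ := h
  have hne : v ≠ T.root := by
    intro hvr
    have : 1 < d v := (hc v).2 ⟨_, ((hvr.trans (hroot hq))).symm⟩
    omega
  have hch := hdeg v
  rw [DirTree.deg, if_neg hne, hv] at hch
  have : T.children v = ∅ := Finset.card_eq_zero.1 (by omega)
  rw [T.f_eq_add_sum_children, this, Finset.sum_empty, add_zero]

theorem stateMu_eq_f (h : IsHuffmanSeq μ d T c) (hq : 0 < q) {i : ℕ} {v : V}
    (hv : stateD d c i v = 1) : stateMu T μ c i v = T.f μ v := by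
  unfold stateMu
  split_ifs with hu
  · rfl
  · rw [stateD, if_neg hu] at hv
    exact (h.f_eq_of_pendent hq hv).symm

theorem weightStep (h : IsHuffmanSeq μ d T c) (i : Fin q) (hi : (i : ℕ) < q - 1) :
    WeightStep ((stateInternal T d c i).val.map fun v => (μ v, d v))
      ((statePendent T d c i).val.map (T.f μ))
      ((stateInternal T d c (i + 1)).val.map fun v => (μ v, d v))
      ((statePendent T d c (i + 1)).val.map (T.f μ)) (T.f μ (c i)) := by
  have hq : 0 < q := by omega
  obtain ⟨hcU, hcd, hLU, hcL, hLcard, hL1, hmin, hmin', hle⟩ := h.2.2.2.2 i hi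
  have hint : ∀ v, 1 < stateD d c i v → stateMu T μ c i v = μ v ∧ stateD d c i v = d v :=
    fun v hv => by
      have := notMem_usedCenters_of_one_lt_stateD hv
      simp [stateMu, stateD, this]
  have hI : stateInternal T d c i = insert (c i) (stateInternal T d c (i + 1)) := by
    ext v
    simp only [stateInternal, stateV_succ, stateD_succ, Finset.mem_insert, Finset.mem_filter,
      Finset.mem_sdiff]
    by_cases hv : v = c i
    · subst hv; simp [hcU, hcd]
    · simp only [hv, if_false, false_or]
      exact ⟨fun ⟨h1, h2⟩ => ⟨⟨h1, fun h3 => by have := hL1 v h3; omega⟩, h2⟩,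
        fun ⟨⟨h1, _⟩, h2⟩ => ⟨h1, h2⟩⟩
  have hcI : c i ∉ stateInternal T d c (i + 1) := by
    simp [stateInternal, stateD_succ]
  have hP : statePendent T d c (i + 1) =
      insert (c i) (statePendent T d c i \ T.children (c i)) := by
    ext v
    simp only [statePendent, stateV_succ, stateD_succ, Finset.mem_insert, Finset.mem_filter,
      Finset.mem_sdiff]
    by_cases hv : v = c i
    · subst hv; simp [hcU, hcL]
    · simp only [hv, if_false, false_or]
      tauto
  have hcP : c i ∉ statePendent T d c i \ T.children (c i) := by
    simp only [statePendent, Finset.mem_sdiff, Finset.mem_filter]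
    rintro ⟨⟨-, h1⟩, -⟩
    omega
  have hLP : T.children (c i) ⊆ statePendent T d c i := fun v hv =>
    Finset.mem_filter.2 ⟨hLU hv, hL1 v hv⟩
  refine ⟨(μ (c i), d (c i)), (T.children (c i)).val.map (T.f μ),
    (statePendent T d c i \ T.children (c i)).val.map (T.f μ), ?_, ?_, ?_, ?_, ?_, ?_, ?_⟩
  · rw [hI, Finset.insert_val_of_notMem hcI, Multiset.map_cons]
  · intro r hr
    obtain ⟨v, hv, rfl⟩ := Multiset.mem_map.1 hr
    obtain ⟨hvU, hvd⟩ := Finset.mem_filter.1 hv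
    have h1 := hmin v hvU hvd
    have h2 := hmin' v hvU hvd
    rw [(hint v hvd).1, (hint _ hcd).1] at h1 h2
    rw [(hint v hvd).2, (hint _ hcd).2] at h2
    exact ⟨h1, h2⟩
  · rw [Multiset.card_map, Finset.card_val, hLcard, (hint _ hcd).2]
  · rw [← Multiset.map_add, Finset.sdiff_val, add_tsub_cancel_of_le (Finset.val_le_iff.2 hLP)]
  · intro a ha b hb
    obtain ⟨u, hu, rfl⟩ := Multiset.mem_map.1 ha
    obtain ⟨w, hw, rfl⟩ := Multiset.mem_map.1 hb
    obtain ⟨hwP, hwL⟩ := Finset.mem_sdiff.1 hw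
    obtain ⟨hwU, hwd⟩ := Finset.mem_filter.1 hwP
    have := hle u hu w hwU hwd hwL
    rwa [h.stateMu_eq_f hq (hL1 u hu), h.stateMu_eq_f hq hwd] at this
  · exact T.f_eq_add_sum_children μ (c i)
  · rw [hP, Finset.insert_val_of_notMem hcP, Multiset.map_cons]

theorem stateInternal_zero : stateInternal T d c 0 = Finset.univ.filter fun v => 1 < d v := by
  ext v
  simp [stateInternal, mem_stateV, stateD, mem_usedCenters]

theorem statePendent_zero : statePendent T d c 0 = Finset.univ.filter fun v => d v = 1 := by
  ext v
  simp [statePendent, mem_stateV, stateD, mem_usedCenters]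

theorem map_statePendent_zero (h : IsHuffmanSeq μ d T c) (hq : 0 < q) :
    (statePendent T d c 0).val.map (T.f μ) =
      (Finset.univ.filter fun v => d v = 1).val.map μ := by
  rw [statePendent_zero]
  exact Multiset.map_congr rfl fun v hv => h.f_eq_of_pendent hq (Finset.mem_filter.1 hv).2

theorem map_usedCenters_succ (h : IsHuffmanSeq μ d T c) (i : Fin q) :
    (usedCenters c (i + 1)).val.map (T.f μ) =
      T.f μ (c i) ::ₘ (usedCenters c i).val.map (T.f μ) := by
  have : c i ∉ usedCenters c i := by
    rw [mem_usedCenters]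
    rintro ⟨j, hj, hji⟩
    rw [h.2.1 hji] at hj
    exact lt_irrefl _ hj
  rw [usedCenters_succ, Finset.insert_val_of_notMem this, Multiset.map_cons]

theorem fvec_eq (h : IsHuffmanSeq μ d T c) (hq : 0 < q) :
    T.fvec μ = (usedCenters c (q - 1)).val.map (T.f μ) := by
  obtain ⟨hdeg, hinj, hc, hroot, -⟩ := h
  have : (Finset.univ.filter fun m => 1 < T.deg m ∧ m ≠ T.root) = usedCenters c (q - 1) := by
    ext v
    simp only [Finset.mem_filter, Finset.mem_univ, true_and, hdeg, hc, mem_usedCenters, hroot hq]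
    constructor
    · rintro ⟨⟨j, rfl⟩, hj⟩
      refine ⟨j, ?_, rfl⟩
      have : (j : ℕ) ≠ q - 1 := fun e => hj (congrArg c (Fin.ext e))
      omega
    · rintro ⟨j, hj, rfl⟩
      refine ⟨⟨j, rfl⟩, fun e => ?_⟩
      have := congrArg Fin.val (hinj e)
      simp only at this
      omega
  rw [DirTree.fvec, this]

/-- Two Huffman sequences for the same tuple produce the same weights at every step. -/
theorem state_weights_eq {H : DirTree V} {c' : Fin q → V} (hT : IsHuffmanSeq μ d T c)
    (hH : IsHuffmanSeq μ d H c') (hq : 0 < q) (i : ℕ) (hi : i ≤ q - 1) :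
    ((stateInternal T d c i).val.map fun v => (μ v, d v)) =
        ((stateInternal H d c' i).val.map fun v => (μ v, d v)) ∧
      (statePendent T d c i).val.map (T.f μ) = (statePendent H d c' i).val.map (H.f μ) ∧
      (usedCenters c i).val.map (T.f μ) = (usedCenters c' i).val.map (H.f μ) := by
  induction i with
  | zero =>
    refine ⟨by simp only [stateInternal_zero], ?_, by simp [usedCenters]⟩
    rw [hT.map_statePendent_zero hq, hH.map_statePendent_zero hq]
  | succ i ih =>
    obtain ⟨hA, hB, hX⟩ := ih (by omega)
    let j : Fin q := ⟨i, by omega⟩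
    have sT := hT.weightStep j (show i < q - 1 by omega)
    have sH := hH.weightStep j (show i < q - 1 by omega)
    have eT := hT.map_usedCenters_succ j
    have eH := hH.map_usedCenters_succ j
    simp only [j] at sT sH eT eH
    rw [hA, hB] at sT
    obtain ⟨h1, h2, h3⟩ := sT.unique sH
    exact ⟨h1, h2, by rw [eT, eH, h3, hX]⟩

end IsHuffmanSeq

/-- all directed Huffman trees of a degree-monotone generating tuple share
the same vector of subordinate groups' weights. -/
theorem huffman_fvec_unique {V : Type} [Fintype V] [DecidableEq V]
    (μ : V → ℝ) (d : V → ℕ) (hgen : IsGenTuple μ d) (hmono : DegMonotone μ d)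
    (T H : DirTree V) (hT : IsHuffmanDir μ d T) (hH : IsHuffmanDir μ d H) :
    T.fvec μ = H.fvec μ := by
  obtain ⟨q, c, hc⟩ := hT
  obtain ⟨q', c', hc'⟩ := hH
  obtain rfl : q = q' := hc.card_eq.trans hc'.card_eq.symm
  have hq : 0 < q := by
    rw [hc.card_eq]
    exact hgen.one_le_internal
  rw [hc.fvec_eq hq, hc'.fvec_eq hq]
  exact (hc.state_weights_eq hc' hq (q - 1) le_rfl).2.2
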